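/- arXiv:1304.0226 — 5 statements merged into one kernel-verified Lean document; each statement's English description precedes it below -/
import Mathlib

section
/- Let R be a ring, rad R its Jacobson radical, and π̃: ℙ(R) → ℙ(R/rad R), p ↦ p̄, the surjection induced by the canonical epimorphism R → R/rad R. Then for all p, q ∈ ℙ(R): p △ q if and only if p̄ △ q̄. -/
/-- `p` is a point of the projective line over `R`. -/
def IsPoint (R : Type*) [Ring R] (p : Submodule R (R × R)) : Prop :=
  ∃ g : (Matrix (Fin 2) (Fin 2) R)ˣ,
    p = Submodule.span R {(g.val 0 0, g.val 0 1)}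

/-- distant relation -/
def Distant {R : Type*} [Ring R] (p q : Submodule R (R × R)) : Prop :=
  ∃ g : (Matrix (Fin 2) (Fin 2) R)ˣ,
    p = Submodule.span R {(g.val 0 0, g.val 0 1)} ∧
    q = Submodule.span R {(g.val 1 0, g.val 1 1)}

def DistantSet {R : Type*} [Ring R] (p : Submodule R (R × R)) :
    Set (Submodule R (R × R)) := {x | Distant x p}

def Parallel {R : Type*} [Ring R] (p q : Submodule R (R × R)) : Prop :=
  DistantSet p ⊆ DistantSet q

def AdjacentVia {R : Type*} [Ring R] (p q r : Submodule R (R × R)) : Prop :=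
  ¬ Parallel r p ∧ ¬ Parallel r q ∧ DistantSet r ⊆ DistantSet p ∪ DistantSet q

def Adjacent {R : Type*} [Ring R] (p q : Submodule R (R × R)) : Prop :=
  ∃ r, IsPoint R r ∧ AdjacentVia p q r

/-- The Jacobson radical of a ring: the intersection of all maximal left ideals. -/
def JacobsonRadical (R : Type*) [Ring R] : Set R :=
  {a | ∀ I : Ideal R, I.IsMaximal → a ∈ I}

/-- A surjective ring homomorphism whose kernel lies in the Jacobson radical reflects units. -/
theorem RingHom.isUnit_of_isUnit_map_of_ker_le_jacobson {A B : Type*} [Ring A] [Ring B]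
    (f : A →+* B) (hf : Function.Surjective f)
    (hker : RingHom.ker f ≤ (⊥ : Ideal A).jacobson) {x : A} (hx : IsUnit (f x)) : IsUnit x := by
  have left_inv : ∀ y, f y = 1 → ∃ z, z * y = 1 := fun y hy ↦ by
    have hmem : y - 1 ∈ (⊥ : Ideal A).jacobson := hker (by simp [RingHom.mem_ker, hy])
    obtain ⟨z, hz⟩ := Ideal.exists_mul_sub_mem_of_sub_one_mem_jacobson y hmem
    exact ⟨z, sub_eq_zero.mp (by simpa using hz)⟩
  have unit_of_map_one : ∀ y, f y = 1 → IsUnit y := fun y hy ↦ by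
    obtain ⟨z, hz⟩ := left_inv y hy
    have hfz : f z = 1 := by simpa [hy] using congrArg f hz
    obtain ⟨w, hw⟩ := left_inv z hfz
    have hwy : w = y := left_inv_eq_right_inv hw hz
    exact ⟨⟨y, z, hwy ▸ hw, hz⟩, rfl⟩
  obtain ⟨u, hu⟩ := hx
  obtain ⟨y, hy⟩ := hf ↑u⁻¹
  obtain ⟨a, ha⟩ := unit_of_map_one (x * y) (by simp [← hu, hy])
  obtain ⟨b, hb⟩ := unit_of_map_one (y * x) (by simp [← hu, hy])
  refine isUnit_iff_exists_and_exists.mpr ⟨⟨y * ↑a⁻¹, ?_⟩, ⟨↑b⁻¹ * y, ?_⟩⟩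
  · rw [← mul_assoc, ← ha, Units.mul_inv]
  · rw [mul_assoc, ← hb, Units.inv_mul]

theorem RingHom.ker_mapMatrix_le_jacobson {n R S : Type*} [Fintype n] [DecidableEq n]
    [Ring R] [Ring S] (f : R →+* S) (hker : RingHom.ker f ≤ (⊥ : Ideal R).jacobson) :
    RingHom.ker (f.mapMatrix (m := n)) ≤ (⊥ : Ideal (Matrix n n R)).jacobson := by
  intro M hM
  rw [← Ideal.matrix_bot n]
  refine Ideal.matrix_jacobson_le ⊥ fun i j ↦ hker ?_
  have hM' : f.mapMatrix M = 0 := hM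
  exact congrFun (congrFun hM' i) j

/-- Two generators of the same cyclic submodule of `R²`, each having a right inverse column,
differ by a unit. -/
theorem exists_unit_smul_of_span_singleton_eq {R : Type*} [Ring R] {u v : R × R}
    (hu : ∃ x y, u.1 * x + u.2 * y = 1) (hv : ∃ x y, v.1 * x + v.2 * y = 1)
    (h : Submodule.span R {u} = Submodule.span R {v}) : ∃ s : Rˣ, u = (s : R) • v := by
  have eq_one : ∀ {w : R × R} {c : R}, (∃ x y, w.1 * x + w.2 * y = 1) → c • w = w → c = 1 := by
    rintro w c ⟨x, y, hxy⟩ hc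
    calc c = c * (w.1 * x + w.2 * y) := by rw [hxy, mul_one]
      _ = (c • w).1 * x + (c • w).2 * y := by simp [mul_add, mul_assoc]
      _ = 1 := by rw [hc, hxy]
  obtain ⟨s, hs⟩ := Submodule.mem_span_singleton.mp
    (h ▸ Submodule.mem_span_singleton_self u : u ∈ Submodule.span R {v})
  obtain ⟨t, ht⟩ := Submodule.mem_span_singleton.mp
    (h ▸ Submodule.mem_span_singleton_self v : v ∈ Submodule.span R {u})
  exact ⟨⟨s, t, eq_one hu (by rw [mul_smul, ht, hs]), eq_one hv (by rw [mul_smul, hs, ht])⟩,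
    hs.symm⟩

theorem Matrix.exists_row_mul_eq_one {R : Type*} [Ring R] (g : (Matrix (Fin 2) (Fin 2) R)ˣ)
    (i : Fin 2) : ∃ x y, g.val i 0 * x + g.val i 1 * y = 1 := by
  refine ⟨g.inv 0 i, g.inv 1 i, ?_⟩
  simpa [Matrix.mul_apply, Fin.sum_univ_two] using congrFun (congrFun g.val_inv i) i

/-- Distance of two points can be tested on any pair of generators having right inverses. -/
theorem distant_span_singleton_iff {R : Type*} [Ring R] {a b c d : R}
    (hab : ∃ x y, a * x + b * y = 1) (hcd : ∃ x y, c * x + d * y = 1) :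
    Distant (Submodule.span R {(a, b)}) (Submodule.span R {(c, d)}) ↔
      IsUnit !![a, b; c, d] := by
  constructor
  · rintro ⟨g, h₀, h₁⟩
    obtain ⟨s, hs⟩ := exists_unit_smul_of_span_singleton_eq hab
      (Matrix.exists_row_mul_eq_one g 0) h₀
    obtain ⟨t, ht⟩ := exists_unit_smul_of_span_singleton_eq hcd
      (Matrix.exists_row_mul_eq_one g 1) h₁
    let D : (Matrix (Fin 2) (Fin 2) R)ˣ :=
      ⟨!![(s : R), 0; 0, (t : R)], !![(↑s⁻¹ : R), 0; 0, (↑t⁻¹ : R)],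
        by simp [Matrix.one_fin_two], by simp [Matrix.one_fin_two]⟩
    refine ⟨D * g, ?_⟩
    simp only [Prod.ext_iff, Prod.smul_fst, Prod.smul_snd, smul_eq_mul] at hs ht
    ext i j
    fin_cases i <;> fin_cases j <;>
      simp [D, Matrix.mul_apply, Fin.sum_univ_two, hs.1, hs.2, ht.1, ht.2]
  · rintro ⟨g, hg⟩
    exact ⟨g, by simp [hg], by simp [hg]⟩

/-- Let `π : R → R̄ = R/rad R` be the canonical epimorphism (encoded as a
surjective ring homomorphism whose kernel is the Jacobson radical) and let `Φ` be the induced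
map `π̃ : ℙ(R) → ℙ(R̄)`, `R(a,b) ↦ R̄(π a, π b)`.  Then for all points `p, q` of `ℙ(R)`:
`p △ q ↔ Φ p △ Φ q`. -/
theorem stmt_2 {R S : Type*} [Ring R] [Ring S] (π : R →+* S)
    (hπsurj : Function.Surjective π)
    (hπker : ∀ a : R, π a = 0 ↔ a ∈ JacobsonRadical R)
    (Φ : Submodule R (R × R) → Submodule S (S × S))
    (hΦ : ∀ a b : R, IsPoint R (Submodule.span R {(a, b)}) →
      Φ (Submodule.span R {(a, b)}) = Submodule.span S {(π a, π b)})
    (p q : Submodule R (R × R)) (hp : IsPoint R p) (hq : IsPoint R q) :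
    Distant p q ↔ Distant (Φ p) (Φ q) := by
  obtain ⟨g, rfl⟩ := hp
  obtain ⟨h, rfl⟩ := hq
  have map_right_inv : ∀ {a b : R}, (∃ x y, a * x + b * y = 1) →
      ∃ x y, π a * x + π b * y = 1 := by
    rintro a b ⟨x, y, hxy⟩
    exact ⟨π x, π y, by rw [← map_mul, ← map_mul, ← map_add, hxy, map_one]⟩
  have hg := Matrix.exists_row_mul_eq_one g 0
  have hh := Matrix.exists_row_mul_eq_one h 0
  have hker : RingHom.ker π ≤ (⊥ : Ideal R).jacobson := fun a ha ↦
    Submodule.mem_sInf.mpr fun I hI ↦ (hπker a).mp ha I hI.2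
  rw [hΦ _ _ ⟨g, rfl⟩, hΦ _ _ ⟨h, rfl⟩, distant_span_singleton_iff hg hh,
    distant_span_singleton_iff (map_right_inv hg) (map_right_inv hh)]
  have hmap : π.mapMatrix !![g.val 0 0, g.val 0 1; h.val 0 0, h.val 0 1] =
      !![π (g.val 0 0), π (g.val 0 1); π (h.val 0 0), π (h.val 0 1)] := by
    ext i j
    fin_cases i <;> fin_cases j <;> rfl
  rw [← hmap]
  have hsurj : Function.Surjective (π.mapMatrix (m := Fin 2)) := fun M ↦
    ⟨M.map (Function.surjInv hπsurj), by
      ext i j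
      exact Function.surjInv_eq hπsurj (M i j)⟩
  exact ⟨fun hu ↦ hu.map π.mapMatrix, RingHom.isUnit_of_isUnit_map_of_ker_le_jacobson _ hsurj
    (RingHom.ker_mapMatrix_le_jacobson π hker)⟩
end

section
/- Let R be a local ring, i.e. a ring in which the set of non-units is an ideal. Then for all p, q ∈ ℙ(R): p △ q if and only if p ∼ q. -/
/-- In a local ring, a right invertible element is a unit. -/
theorem IsLocalRing.isUnit_of_mul_eq_one {R : Type*} [Ring R] [IsLocalRing R] {a b : R}
    (h : a * b = 1) : IsUnit a := by
  have idem : b * a * (b * a) = b * a := by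
    rw [mul_assoc, ← mul_assoc a, h, one_mul]
  rcases IsLocalRing.isUnit_or_isUnit_of_add_one (add_sub_cancel (b * a) 1) with hu | hu
  · have hba : b * a = 1 := hu.mul_left_cancel (by rw [idem, mul_one])
    exact ⟨⟨a, b, h, hba⟩, rfl⟩
  · have hba : b * a = 0 := hu.mul_left_cancel (by rw [sub_mul, idem, one_mul, sub_self, mul_zero])
    have : (1 : R) = 0 := by
      calc (1 : R) = a * (b * a) * b := by rw [← mul_assoc, h, one_mul, h]
        _ = 0 := by rw [hba, mul_zero, zero_mul]
    exact absurd this one_ne_zero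

/-- In a local ring, a right invertible product has a left factor that is a unit. -/
theorem IsLocalRing.isUnit_of_isUnit_mul {R : Type*} [Ring R] [IsLocalRing R] {a b : R}
    (h : IsUnit (a * b)) : IsUnit a := by
  obtain ⟨c, hc⟩ := h.exists_right_inv
  exact IsLocalRing.isUnit_of_mul_eq_one (b := b * c) (by rw [← mul_assoc, hc])

section UnitMatrices

variable {R : Type*} [Ring R]

/-- The invertible matrix with rows `(a, b)` and `(0, 1)`. -/
def unitUpper (a : Rˣ) (b : R) : (Matrix (Fin 2) (Fin 2) R)ˣ where
  val := !![(a : R), b; 0, 1]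
  inv := !![((a⁻¹ : Rˣ) : R), -(((a⁻¹ : Rˣ) : R) * b); 0, 1]
  val_inv := by simp [Matrix.one_fin_two]
  inv_val := by simp [Matrix.one_fin_two]

/-- The invertible matrix with rows `(a, b)` and `(1, 0)`. -/
def unitAnti (a : R) (b : Rˣ) : (Matrix (Fin 2) (Fin 2) R)ˣ where
  val := !![a, (b : R); 1, 0]
  inv := !![0, 1; ((b⁻¹ : Rˣ) : R), -(((b⁻¹ : Rˣ) : R) * a)]
  val_inv := by simp [Matrix.one_fin_two]
  inv_val := by simp [Matrix.one_fin_two]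

end UnitMatrices

theorem Distant.symm {R : Type*} [Ring R] {p q : Submodule R (R × R)} (h : Distant p q) :
    Distant q p := by
  obtain ⟨g, rfl, rfl⟩ := h
  exact ⟨unitAnti 0 1 * g, by simp [unitAnti, Matrix.mul_apply], by
    simp [unitAnti, Matrix.mul_apply]⟩

theorem not_distant_self {R : Type*} [Ring R] [Nontrivial R] (p : Submodule R (R × R)) :
    ¬ Distant p p := by
  rintro ⟨g, rfl, hq⟩
  have hmem : (g.val 1 0, g.val 1 1) ∈ Submodule.span R {(g.val 0 0, g.val 0 1)} :=
    hq ▸ Submodule.mem_span_singleton_self _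
  obtain ⟨c, hc⟩ := Submodule.mem_span_singleton.mp hmem
  simp only [Prod.smul_mk, smul_eq_mul, Prod.mk.injEq] at hc
  have hinv := g.val_inv
  have h01 : g.val 0 0 * g.inv 0 1 + g.val 0 1 * g.inv 1 1 = 0 := by
    simpa [Matrix.mul_apply] using congrFun (congrFun hinv 0) 1
  have h11 : g.val 1 0 * g.inv 0 1 + g.val 1 1 * g.inv 1 1 = 1 := by
    simpa [Matrix.mul_apply] using congrFun (congrFun hinv 1) 1
  rw [← hc.1, ← hc.2, mul_assoc, mul_assoc, ← mul_add, h01, mul_zero] at h11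
  exact zero_ne_one h11

theorem IsPoint.distant_or_distant {R : Type*} [Ring R] [IsLocalRing R]
    {x p q : Submodule R (R × R)} (hx : IsPoint R x) (h : Distant p q) :
    Distant x p ∨ Distant x q := by
  obtain ⟨g, rfl, rfl⟩ := h
  obtain ⟨k, rfl⟩ := hx
  obtain ⟨k, rfl⟩ : ∃ k', k = k' * g := ⟨k * g⁻¹, by simp⟩
  have h00 : k.val 0 0 * k.inv 0 0 + k.val 0 1 * k.inv 1 0 = 1 := by
    simpa [Matrix.mul_apply] using congrFun (congrFun k.val_inv 0) 0
  rcases IsLocalRing.isUnit_or_isUnit_of_add_one h00 with hu | hu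
  · obtain ⟨a, ha⟩ := IsLocalRing.isUnit_of_isUnit_mul hu
    exact Or.inr ⟨unitUpper a (k.val 0 1) * g, by simp [unitUpper, Matrix.mul_apply, ha], by
      simp [unitUpper, Matrix.mul_apply]⟩
  · obtain ⟨b, hb⟩ := IsLocalRing.isUnit_of_isUnit_mul hu
    exact Or.inl ⟨unitAnti (k.val 0 0) b * g, by simp [unitAnti, Matrix.mul_apply, hb], by
      simp [unitAnti, Matrix.mul_apply]⟩

theorem Distant.isPoint {R : Type*} [Ring R] {p q : Submodule R (R × R)} (h : Distant p q) :
    IsPoint R p :=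
  h.imp fun _ hg => hg.1

/-- Two distant points have a common distant point. -/
theorem Distant.exists_distant_distant {R : Type*} [Ring R] {p q : Submodule R (R × R)}
    (h : Distant p q) : ∃ r, Distant r p ∧ Distant r q := by
  obtain ⟨g, rfl, rfl⟩ := h
  exact ⟨_, ⟨unitAnti 1 1 * g, rfl, by simp [unitAnti, Matrix.mul_apply]⟩,
    ⟨unitUpper 1 1 * g, by simp [unitUpper, unitAnti, Matrix.mul_apply], by
      simp [unitUpper, Matrix.mul_apply]⟩⟩

theorem Distant.not_parallel {R : Type*} [Ring R] [Nontrivial R] {p q : Submodule R (R × R)}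
    (h : Distant p q) : ¬ Parallel p q :=
  fun hpar => not_distant_self q (hpar h.symm)

/-- If `R` is a local ring (the non-units form an ideal), then for all
points `p, q` of `ℙ(R)`: `p △ q ↔ p ∼ q`. -/
theorem stmt_4 {R : Type*} [Ring R] [IsLocalRing R]
    (p q : Submodule R (R × R)) (hp : IsPoint R p) (hq : IsPoint R q) :
    Distant p q ↔ Adjacent p q := by
  constructor
  · intro h
    obtain ⟨r, hrp, hrq⟩ := h.exists_distant_distant
    exact ⟨r, hrp.isPoint, hrp.not_parallel, hrq.not_parallel, fun x hx =>
      Distant.isPoint hx |>.distant_or_distant h⟩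
  · rintro ⟨r, -, hrp, -, hsub⟩
    obtain ⟨x, hxr, hxp⟩ := Set.not_subset.mp hrp
    have hxq : Distant x q := (hsub hxr).resolve_left hxp
    exact (hp.distant_or_distant hxq).resolve_left fun hpx => hxp hpx.symm
end

section
/- Let R and R' be rings. There exists a ∥-isomorphism ℙ(R) → ℙ(R') if and only if the Jacobson radicals rad R and rad R' have the same cardinality and the projective lines ℙ(R/rad R) and ℙ(R'/rad R') have the same cardinality. -/
theorem isUnit_of_isUnit_map {A B : Type*} [Ring A] [Ring B] (f : A →+* B)
    (hf : Function.Surjective f) (hker : ∀ a, f a = 0 → ∃ z, z * (1 + a) = 1) {a : A}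
    (ha : IsUnit (f a)) : IsUnit a := by
  have key : ∀ x, f x = 1 → ∃ z, z * x = 1 ∧ x * z = 1 := by
    have left : ∀ x, f x = 1 → ∃ z, z * x = 1 := fun x hx => by
      obtain ⟨z, hz⟩ := hker (x - 1) (by simp [hx])
      exact ⟨z, by simpa using hz⟩
    intro x hx
    obtain ⟨z, hz⟩ := left x hx
    have hfz : f z = 1 := by simpa [hx] using congrArg f hz
    obtain ⟨w, hw⟩ := left z hfz
    have : w = x := left_inv_eq_right_inv hw hz
    exact ⟨z, hz, this ▸ hw⟩
  obtain ⟨u, hu⟩ := ha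
  obtain ⟨b, hb⟩ := hf (↑u⁻¹ : B)
  obtain ⟨z, hz, -⟩ := key (b * a) (by rw [map_mul, hb, ← hu, Units.inv_mul])
  obtain ⟨y, -, hy⟩ := key (a * b) (by rw [map_mul, hb, ← hu, Units.mul_inv])
  rw [← mul_assoc] at hz
  rw [mul_assoc] at hy
  exact isUnit_iff_exists.2 ⟨b * y, hy, by rwa [← left_inv_eq_right_inv hz hy]⟩

theorem isUnit_one_add_mul_comm {A : Type*} [Ring A] {a b : A} (h : IsUnit (1 + a * b)) :
    IsUnit (1 + b * a) := by
  obtain ⟨z, h1, h2⟩ := isUnit_iff_exists.1 h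
  refine isUnit_iff_exists.2 ⟨1 - b * z * a, ?_, ?_⟩
  · have : (1 + b * a) * (1 - b * z * a) = 1 + b * a - b * ((1 + a * b) * z) * a := by noncomm_ring
    rw [this, h1]; noncomm_ring
  · have : (1 - b * z * a) * (1 + b * a) = 1 + b * a - b * (z * (1 + a * b)) * a := by noncomm_ring
    rw [this, h2]; noncomm_ring

theorem mem_jacobsonRadical_iff {R : Type*} [Ring R] (a : R) :
    a ∈ JacobsonRadical R ↔ a ∈ Ideal.jacobson (⊥ : Ideal R) := by
  simp [JacobsonRadical, Ideal.jacobson, Submodule.mem_sInf]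

theorem mem_jacobsonRadical_of_isUnit {R : Type*} [Ring R] {a : R}
    (h : ∀ s, IsUnit (1 + s * a)) : a ∈ JacobsonRadical R := by
  rw [mem_jacobsonRadical_iff, Ideal.mem_jacobson_iff]
  intro y
  obtain ⟨z, -, hz⟩ := isUnit_iff_exists.1 (h y)
  refine ⟨z, ?_⟩
  rw [Ideal.mem_bot, sub_eq_zero, ← hz]
  noncomm_ring

theorem isUnit_of_isUnit_map_of_ker {R S : Type*} [Ring R] [Ring S] {π : R →+* S}
    (hπ : Function.Surjective π) (hker : ∀ a : R, π a = 0 ↔ a ∈ JacobsonRadical R) {a : R}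
    (ha : IsUnit (π a)) : IsUnit a := by
  refine isUnit_of_isUnit_map π hπ (fun x hx => ?_) ha
  rw [hker, mem_jacobsonRadical_iff, Ideal.mem_jacobson_iff] at hx
  obtain ⟨z, hz⟩ := hx 1
  refine ⟨z, ?_⟩
  rw [Ideal.mem_bot, sub_eq_zero, mul_one] at hz
  rw [mul_add, mul_one, add_comm, hz]

theorem isUnit_of_isUnit_mapMatrix_of_ker {n R S : Type*} [Fintype n] [DecidableEq n] [Ring R]
    [Ring S] {π : R →+* S} (hπ : Function.Surjective π)
    (hker : ∀ a : R, π a = 0 ↔ a ∈ JacobsonRadical R) {M : Matrix n n R}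
    (hM : IsUnit (π.mapMatrix M)) : IsUnit M := by
  refine isUnit_of_isUnit_map π.mapMatrix (fun N => ?_) (fun X hX => ?_) hM
  · choose f hf using fun i j => hπ (N i j)
    exact ⟨f, by ext i j; exact hf i j⟩
  · have hmem : X ∈ (⊥ : TwoSidedIdeal (Matrix n n R)).jacobson := by
      rw [← TwoSidedIdeal.matrix_jacobson_bot, TwoSidedIdeal.mem_matrix]
      intro i j
      have h0 : π (X i j) = 0 := congrFun (congrFun hX i) j
      rw [hker, mem_jacobsonRadical_iff, Ideal.mem_jacobson_iff] at h0
      rw [TwoSidedIdeal.mem_jacobson_iff]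
      simpa using h0
    obtain ⟨z, hz⟩ := TwoSidedIdeal.mem_jacobson_iff.1 hmem 1
    refine ⟨z, ?_⟩
    rw [TwoSidedIdeal.mem_bot, sub_eq_zero, mul_one] at hz
    rw [mul_add, mul_one, add_comm, hz]

/-- The rows `v` and `w` form an invertible matrix. -/
def IsBasisPair {R : Type*} [Ring R] (v w : R × R) : Prop :=
  IsUnit !![v.1, v.2; w.1, w.2]

theorem isPoint_iff {R : Type*} [Ring R] {p : Submodule R (R × R)} :
    IsPoint R p ↔ ∃ v w, IsBasisPair v w ∧ p = Submodule.span R {v} := by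
  constructor
  · rintro ⟨g, rfl⟩
    refine ⟨(g.val 0 0, g.val 0 1), (g.val 1 0, g.val 1 1), ?_, rfl⟩
    simp only [IsBasisPair, ← Matrix.eta_fin_two]
    exact g.isUnit
  · rintro ⟨v, w, ⟨g, hg⟩, rfl⟩
    exact ⟨g, by simp [hg]⟩

theorem distant_iff {R : Type*} [Ring R] {p q : Submodule R (R × R)} :
    Distant p q ↔
      ∃ v w, IsBasisPair v w ∧ p = Submodule.span R {v} ∧ q = Submodule.span R {w} := by
  constructor
  · rintro ⟨g, rfl, rfl⟩
    refine ⟨(g.val 0 0, g.val 0 1), (g.val 1 0, g.val 1 1), ?_, rfl, rfl⟩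
    simp only [IsBasisPair, ← Matrix.eta_fin_two]
    exact g.isUnit
  · rintro ⟨v, w, ⟨g, hg⟩, rfl, rfl⟩
    exact ⟨g, by simp [hg]⟩

namespace IsBasisPair

variable {R : Type*} [Ring R] {v w : R × R}

theorem comb_iff (h : IsBasisPair v w) (a b c d : R) :
    IsBasisPair (a • v + b • w) (c • v + d • w) ↔ IsUnit !![a, b; c, d] := by
  obtain ⟨g, hg⟩ := h
  have : !![(a • v + b • w).1, (a • v + b • w).2; (c • v + d • w).1, (c • v + d • w).2] =
      !![a, b; c, d] * g.val := by
    rw [hg, Matrix.mul_fin_two]; simp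
  rw [IsBasisPair, this, Units.isUnit_mul_units]

theorem symm (h : IsBasisPair v w) : IsBasisPair w v := by
  have := (h.comb_iff 0 1 1 0).2 (isUnit_iff_exists.2
    ⟨!![0, 1; 1, 0], by simp [Matrix.one_fin_two], by simp [Matrix.one_fin_two]⟩)
  simpa using this

theorem add_smul_left (h : IsBasisPair v w) (s : R) : IsBasisPair (v + s • w) w := by
  have := (h.comb_iff 1 s 0 1).2 (isUnit_iff_exists.2
    ⟨!![1, -s; 0, 1], by simp [Matrix.one_fin_two], by simp [Matrix.one_fin_two]⟩)
  simpa using this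

theorem units_smul (h : IsBasisPair v w) (s t : Rˣ) :
    IsBasisPair ((s : R) • v) ((t : R) • w) := by
  have := (h.comb_iff s 0 0 t).2 (isUnit_iff_exists.2
    ⟨!![↑s⁻¹, 0; 0, ↑t⁻¹], by simp [Matrix.one_fin_two], by simp [Matrix.one_fin_two]⟩)
  simpa using this

theorem exists_eq (h : IsBasisPair v w) (u : R × R) : ∃ x y : R, u = x • v + y • w := by
  obtain ⟨g, hg⟩ := h
  have key := Units.inv_mul g
  refine ⟨u.1 * g⁻¹.val 0 0 + u.2 * g⁻¹.val 1 0, u.1 * g⁻¹.val 0 1 + u.2 * g⁻¹.val 1 1, ?_⟩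
  rw [hg, Matrix.eta_fin_two g⁻¹.val, Matrix.mul_fin_two, Matrix.one_fin_two] at key
  have h00 := congrFun (congrFun key 0) 0
  have h01 := congrFun (congrFun key 0) 1
  have h10 := congrFun (congrFun key 1) 0
  have h11 := congrFun (congrFun key 1) 1
  simp only [Matrix.of_apply, Matrix.cons_val_zero, Matrix.cons_val_one, Matrix.cons_val',
    Matrix.cons_val_fin_one] at h00 h01 h10 h11
  ext
  · calc u.1 = u.1 * 1 + u.2 * 0 := by simp
      _ = _ := by
        rw [← h00, ← h10]
        simp only [Prod.fst_add, Prod.smul_fst, smul_eq_mul]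
        noncomm_ring
  · calc u.2 = u.1 * 0 + u.2 * 1 := by simp
      _ = _ := by
        rw [← h01, ← h11]
        simp only [Prod.snd_add, Prod.smul_snd, smul_eq_mul]
        noncomm_ring

theorem eq_zero (h : IsBasisPair v w) {x y : R} (hxy : x • v + y • w = 0) : x = 0 ∧ y = 0 := by
  obtain ⟨g, hg⟩ := h
  have hz : !![x, y; 0, 0] * g.val = 0 := by
    have h1 := congrArg Prod.fst hxy
    have h2 := congrArg Prod.snd hxy
    simp only [Prod.fst_add, Prod.smul_fst, smul_eq_mul, Prod.snd_add, Prod.smul_snd,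
      Prod.fst_zero, Prod.snd_zero] at h1 h2
    rw [hg, Matrix.mul_fin_two, h1, h2]
    ext i j; fin_cases i <;> fin_cases j <;> simp
  rw [Units.mul_left_eq_zero] at hz
  exact ⟨congrFun (congrFun hz 0) 0, congrFun (congrFun hz 0) 1⟩

theorem coeff_ext (h : IsBasisPair v w) {x y x' y' : R}
    (hxy : x • v + y • w = x' • v + y' • w) : x = x' ∧ y = y' := by
  have := h.eq_zero (x := x - x') (y := y - y') (by
    rw [sub_smul, sub_smul, sub_add_sub_comm, hxy, sub_self])
  simpa [sub_eq_zero] using this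

theorem exists_unit_smul (h : IsBasisPair v w) {v' w' : R × R} (h' : IsBasisPair v' w')
    (hspan : Submodule.span R {v} = Submodule.span R {v'}) : ∃ s : Rˣ, v' = (s : R) • v := by
  have h1 : v' ∈ Submodule.span R {v} := hspan ▸ Submodule.mem_span_singleton_self v'
  have h2 : v ∈ Submodule.span R {v'} := hspan ▸ Submodule.mem_span_singleton_self v
  obtain ⟨s, hs⟩ := Submodule.mem_span_singleton.1 h1
  obtain ⟨t, ht⟩ := Submodule.mem_span_singleton.1 h2
  have hts : t * s = 1 := (h.coeff_ext (y := 0) (y' := 0) (by simp [mul_smul, hs, ht])).1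
  have hst : s * t = 1 := (h'.coeff_ext (y := 0) (y' := 0) (by simp [mul_smul, hs, ht])).1
  exact ⟨⟨s, t, hst, hts⟩, hs.symm⟩

theorem distant_span_iff {v' w' : R × R} (hv : IsBasisPair v v') (hw : IsBasisPair w w') :
    Distant (Submodule.span R {v}) (Submodule.span R {w}) ↔ IsBasisPair v w := by
  refine ⟨fun h => ?_, fun h => distant_iff.2 ⟨v, w, h, rfl, rfl⟩⟩
  obtain ⟨a, b, hab, ha, hb⟩ := distant_iff.1 h
  obtain ⟨s, rfl⟩ := hab.exists_unit_smul hv ha.symm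
  obtain ⟨t, rfl⟩ := hab.symm.exists_unit_smul hw hb.symm
  exact hab.units_smul s t

end IsBasisPair

theorem span_singleton_units_smul {R M : Type*} [Ring R] [AddCommGroup M] [Module R M] (s : Rˣ)
    (v : M) : Submodule.span R {(s : R) • v} = Submodule.span R {v} :=
  Submodule.span_singleton_group_smul_eq R s v

theorem isUnit_sub_mul_of_isUnit {R : Type*} [Ring R] {s c d : R} (h : IsUnit !![1, s; c, d]) :
    IsUnit (d - c * s) := by
  obtain ⟨g, hg⟩ := h
  have h1 := Units.inv_mul g
  have h2 := Units.mul_inv g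
  rw [hg, Matrix.eta_fin_two g⁻¹.val, Matrix.mul_fin_two, Matrix.one_fin_two] at h1 h2
  have a10 := congrFun (congrFun h1 1) 0
  have a11 := congrFun (congrFun h1 1) 1
  have b01 := congrFun (congrFun h2 0) 1
  have b11 := congrFun (congrFun h2 1) 1
  simp only [Matrix.of_apply, Matrix.cons_val_zero, Matrix.cons_val_one, Matrix.cons_val',
    Matrix.cons_val_fin_one, mul_one, one_mul] at a10 a11 b01 b11
  refine isUnit_iff_exists.2 ⟨g⁻¹.val 1 1, ?_, ?_⟩
  · rw [sub_mul, mul_assoc, ← b11, eq_neg_of_add_eq_zero_left b01]; noncomm_ring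
  · rw [mul_sub, ← mul_assoc, ← a11, eq_neg_of_add_eq_zero_left a10]; noncomm_ring

/-- The submodule of `S × S` generated by the image of `p` under a ring homomorphism. -/
def mapLine {R S : Type*} [Ring R] [Ring S] (π : R →+* S) (p : Submodule R (R × R)) :
    Submodule S (S × S) :=
  Submodule.span S (Prod.map π π '' p)

section Reduction

variable {R S : Type*} [Ring R] [Ring S] (π : R →+* S)

theorem prodMap_smul (r : R) (v : R × R) : Prod.map π π (r • v) = π r • Prod.map π π v := by
  ext <;> simp

theorem prodMap_add (v w : R × R) :
    Prod.map π π (v + w) = Prod.map π π v + Prod.map π π w := by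
  ext <;> simp

theorem mapLine_span_singleton (v : R × R) :
    mapLine π (Submodule.span R {v}) = Submodule.span S {Prod.map π π v} := by
  apply le_antisymm
  · rw [mapLine, Submodule.span_le]
    rintro _ ⟨u, hu, rfl⟩
    obtain ⟨r, rfl⟩ := Submodule.mem_span_singleton.1 hu
    exact Submodule.mem_span_singleton.2 ⟨π r, (prodMap_smul π r v).symm⟩
  · rw [Submodule.span_singleton_le_iff_mem]
    exact Submodule.subset_span ⟨v, Submodule.mem_span_singleton_self v, rfl⟩

theorem mapMatrix_rows (v w : R × R) :
    π.mapMatrix !![v.1, v.2; w.1, w.2] =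
      !![(Prod.map π π v).1, (Prod.map π π v).2; (Prod.map π π w).1, (Prod.map π π w).2] := by
  ext i j; fin_cases i <;> fin_cases j <;> rfl

variable {π}

theorem IsBasisPair.map {v w : R × R} (h : IsBasisPair v w) :
    IsBasisPair (Prod.map π π v) (Prod.map π π w) := by
  rw [IsBasisPair, ← mapMatrix_rows]
  exact IsUnit.map π.mapMatrix h

theorem isPoint_mapLine {p : Submodule R (R × R)} (hp : IsPoint R p) :
    IsPoint S (mapLine π p) := by
  obtain ⟨v, w, h, rfl⟩ := isPoint_iff.1 hp
  exact isPoint_iff.2 ⟨_, _, h.map, mapLine_span_singleton π v⟩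

theorem IsBasisPair.of_map (hπ : Function.Surjective π)
    (hker : ∀ a : R, π a = 0 ↔ a ∈ JacobsonRadical R) {v w : R × R}
    (h : IsBasisPair (Prod.map π π v) (Prod.map π π w)) : IsBasisPair v w := by
  rw [IsBasisPair, ← mapMatrix_rows] at h
  exact isUnit_of_isUnit_mapMatrix_of_ker hπ hker h

theorem exists_isPoint_mapLine_eq (hπ : Function.Surjective π)
    (hker : ∀ a : R, π a = 0 ↔ a ∈ JacobsonRadical R) {p : Submodule S (S × S)}
    (hp : IsPoint S p) : ∃ q, IsPoint R q ∧ mapLine π q = p := by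
  obtain ⟨v, w, h, rfl⟩ := isPoint_iff.1 hp
  obtain ⟨v, rfl⟩ := hπ.prodMap hπ v
  obtain ⟨w, rfl⟩ := hπ.prodMap hπ w
  exact ⟨Submodule.span R {v}, isPoint_iff.2 ⟨v, w, h.of_map hπ hker, rfl⟩,
    mapLine_span_singleton π v⟩

theorem parallel_iff_mapLine_eq (hπ : Function.Surjective π)
    (hker : ∀ a : R, π a = 0 ↔ a ∈ JacobsonRadical R) {p q : Submodule R (R × R)}
    (hp : IsPoint R p) (hq : IsPoint R q) :
    Parallel p q ↔ mapLine π p = mapLine π q := by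
  obtain ⟨w, v, hwv, rfl⟩ := isPoint_iff.1 hp
  obtain ⟨u, u', hu, rfl⟩ := isPoint_iff.1 hq
  constructor
  · intro hpar
    obtain ⟨d, c, rfl⟩ := hwv.exists_eq u
    have hunit : ∀ s, IsUnit (d - c * s) := fun s => by
      have hvw := hwv.symm.add_smul_left s
      have hd : Distant (Submodule.span R {v + s • w}) (Submodule.span R {d • w + c • v}) :=
        hpar (distant_iff.2 ⟨_, _, hvw, rfl, rfl⟩)
      have hb := (IsBasisPair.distant_span_iff hvw hu).1 hd
      refine isUnit_sub_mul_of_isUnit ((hwv.symm.comb_iff 1 s c d).1 ?_)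
      rwa [one_smul, add_comm (c • v)]
    obtain ⟨e, rfl⟩ : IsUnit d := by simpa using hunit 0
    have hc : π c = 0 := by
      rw [hker]
      refine mem_jacobsonRadical_of_isUnit fun s => isUnit_one_add_mul_comm ?_
      have := (hunit (-(s * e))).mul e⁻¹.isUnit
      convert this using 1
      rw [sub_mul, Units.mul_inv, mul_neg, neg_mul, sub_neg_eq_add, ← mul_assoc, mul_assoc _ e.val,
        Units.mul_inv, mul_one]
    rw [mapLine_span_singleton, mapLine_span_singleton, prodMap_add, prodMap_smul, prodMap_smul, hc,
      zero_smul, add_zero]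
    exact (span_singleton_units_smul (Units.map π.toMonoidHom e) _).symm
  · intro heq x hx
    obtain ⟨a, b, hab, rfl, hb⟩ := distant_iff.1 hx
    rw [hb, mapLine_span_singleton, mapLine_span_singleton] at heq
    obtain ⟨s, hs⟩ := hab.symm.map.exists_unit_smul hu.map heq
    have h : IsBasisPair (Prod.map π π a) (Prod.map π π u) := by
      rw [hs]
      simpa using hab.map.units_smul (1 : Sˣ) s
    exact distant_iff.2 ⟨a, u, h.of_map hπ hker, rfl, rfl⟩

/-- Every fibre of the reduction map on points is in bijection with the radical. -/
theorem nonempty_equiv_fiber_mapLine (hπ : Function.Surjective π)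
    (hker : ∀ a : R, π a = 0 ↔ a ∈ JacobsonRadical R) {q : Submodule S (S × S)}
    (hq : IsPoint S q) :
    Nonempty (JacobsonRadical R ≃ {p : {p // IsPoint R p} // mapLine π p.1 = q}) := by
  obtain ⟨q₀, hq₀, rfl⟩ := exists_isPoint_mapLine_eq hπ hker hq
  obtain ⟨v, w, h, rfl⟩ := isPoint_iff.1 hq₀
  refine ⟨Equiv.ofBijective (fun j => ⟨⟨Submodule.span R {v + j.1 • w},
    isPoint_iff.2 ⟨_, _, h.add_smul_left j.1, rfl⟩⟩, ?_⟩) ⟨fun j j' hjj => ?_, ?_⟩⟩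
  · rw [mapLine_span_singleton, mapLine_span_singleton, prodMap_add, prodMap_smul,
      (hker _).2 j.2, zero_smul, add_zero]
  · have heq := congrArg (fun x => x.1.1) hjj
    obtain ⟨s, hs⟩ := (h.add_smul_left j.1).exists_unit_smul (h.add_smul_left j'.1) heq
    have := h.coeff_ext (x := 1) (y := j'.1) (x' := s) (y' := s * j.1)
      (by rw [one_smul, hs, smul_add, mul_smul])
    rw [← this.1, one_mul] at this
    exact Subtype.ext this.2.symm
  · rintro ⟨⟨p, hp⟩, hpq⟩
    obtain ⟨u, u', hu, rfl⟩ := isPoint_iff.1 hp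
    obtain ⟨x, y, rfl⟩ := h.exists_eq u
    rw [mapLine_span_singleton, mapLine_span_singleton] at hpq
    obtain ⟨s, hs⟩ := h.map.exists_unit_smul hu.map hpq.symm
    rw [prodMap_add, prodMap_smul, prodMap_smul] at hs
    obtain ⟨hx, hy⟩ := h.map.coeff_ext (x' := (s : S)) (y' := 0) (by rw [hs, zero_smul, add_zero])
    obtain ⟨t, rfl⟩ := isUnit_of_isUnit_map_of_ker hπ hker (hx ▸ s.isUnit)
    refine ⟨⟨↑t⁻¹ * y, (hker _).1 (by rw [map_mul, hy, mul_zero])⟩, ?_⟩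
    refine Subtype.ext (Subtype.ext ?_)
    change Submodule.span R {v + (↑t⁻¹ * y) • w} = Submodule.span R {(t : R) • v + y • w}
    rw [← span_singleton_units_smul t, smul_add, smul_smul, Units.mul_inv_cancel_left]

end Reduction

theorem exists_equiv_preserving_fibers_iff {X X' : Type u} {Y Y' : Type v} {A A' : Type u}
    [Nonempty Y] {f : X → Y} {f' : X' → Y'} (hf : Function.Surjective f)
    (hf' : Function.Surjective f') (e : ∀ y, Nonempty (A ≃ {x // f x = y}))
    (e' : ∀ y, Nonempty (A' ≃ {x // f' x = y})) :
    (∃ φ : X ≃ X', ∀ x y, f x = f y ↔ f' (φ x) = f' (φ y)) ↔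
      Cardinal.mk A = Cardinal.mk A' ∧ Cardinal.mk Y = Cardinal.mk Y' := by
  constructor
  · rintro ⟨φ, hφ⟩
    constructor
    · obtain ⟨x, -⟩ := hf (Classical.arbitrary Y)
      obtain ⟨a⟩ := e (f x)
      obtain ⟨b⟩ := e' (f' (φ x))
      exact Cardinal.mk_congr ((a.trans (φ.subtypeEquiv fun z => hφ z x)).trans b.symm)
    · have hg := Function.surjInv_eq hf
      refine Cardinal.mk_congr (Equiv.ofBijective (fun y => f' (φ (Function.surjInv hf y)))
        ⟨fun y z hyz => ?_, fun y' => ?_⟩)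
      · rw [← hg y, ← hg z]
        exact (hφ _ _).2 hyz
      · obtain ⟨x', rfl⟩ := hf' y'
        refine ⟨f (φ.symm x'), ?_⟩
        simpa using (hφ (Function.surjInv hf (f (φ.symm x'))) (φ.symm x')).1 (hg _)
  · rintro ⟨hA, hY⟩
    obtain ⟨α⟩ := Cardinal.eq.1 hA
    obtain ⟨β⟩ := Cardinal.eq.1 hY
    let fiberwise : ∀ y, {x // f x = y} ≃ {x // f' x = β y} := fun y =>
      ((e y).some.symm.trans α).trans (e' (β y)).some
    let φ : X ≃ X' := (Equiv.sigmaFiberEquiv f).symm.trans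
      ((Equiv.sigmaCongr β fiberwise).trans (Equiv.sigmaFiberEquiv f'))
    have hφ : ∀ x, f' (φ x) = β (f x) := fun x => (fiberwise (f x) ⟨x, rfl⟩).2
    exact ⟨φ, fun x y => by rw [hφ, hφ, β.apply_eq_iff_eq]⟩

/-- Let `R`, `R'` be rings, with quotients `R̄ = R/rad R`, `R̄' = R'/rad R'`
(encoded as surjective ring homomorphisms `π, π'` whose kernels are the Jacobson radicals).
There exists a `∥`-isomorphism `ℙ(R) → ℙ(R')` iff `#(rad R) = #(rad R')` and
`#ℙ(R̄) = #ℙ(R̄')`. -/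
theorem stmt_6 {R R' : Type u} {S S' : Type v} [Ring R] [Ring R'] [Ring S] [Ring S']
    (π : R →+* S) (hπsurj : Function.Surjective π)
    (hπker : ∀ a : R, π a = 0 ↔ a ∈ JacobsonRadical R)
    (π' : R' →+* S') (hπ'surj : Function.Surjective π')
    (hπ'ker : ∀ a : R', π' a = 0 ↔ a ∈ JacobsonRadical R') :
    (∃ φ : {p : Submodule R (R × R) // IsPoint R p} ≃ {p' : Submodule R' (R' × R') // IsPoint R' p'},
        ∀ p q : {p : Submodule R (R × R) // IsPoint R p},
          (Parallel p.1 q.1 ↔ Parallel (φ p).1 (φ q).1)) ↔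
      (Cardinal.mk (JacobsonRadical R) = Cardinal.mk (JacobsonRadical R') ∧
        Cardinal.mk {p : Submodule S (S × S) // IsPoint S p} =
          Cardinal.mk {p' : Submodule S' (S' × S') // IsPoint S' p'}) := by
  let f : {p : Submodule R (R × R) // IsPoint R p} → {p : Submodule S (S × S) // IsPoint S p} :=
    fun p => ⟨mapLine π p.1, isPoint_mapLine p.2⟩
  let f' : {p : Submodule R' (R' × R') // IsPoint R' p} →
      {p : Submodule S' (S' × S') // IsPoint S' p} :=
    fun p => ⟨mapLine π' p.1, isPoint_mapLine p.2⟩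
  have hf : Function.Surjective f := fun ⟨q, hq⟩ => by
    obtain ⟨p, hp, rfl⟩ := exists_isPoint_mapLine_eq hπsurj hπker hq
    exact ⟨⟨p, hp⟩, rfl⟩
  have hf' : Function.Surjective f' := fun ⟨q, hq⟩ => by
    obtain ⟨p, hp, rfl⟩ := exists_isPoint_mapLine_eq hπ'surj hπ'ker hq
    exact ⟨⟨p, hp⟩, rfl⟩
  have : Nonempty {p : Submodule S (S × S) // IsPoint S p} := ⟨⟨_, 1, rfl⟩⟩
  rw [← exists_equiv_preserving_fibers_iff hf hf'
    (fun y => (nonempty_equiv_fiber_mapLine hπsurj hπker y.2).map fun e =>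
      e.trans (Equiv.subtypeEquivRight fun p => (Subtype.ext_iff (a1 := f p)).symm))
    (fun y => (nonempty_equiv_fiber_mapLine hπ'surj hπ'ker y.2).map fun e =>
      e.trans (Equiv.subtypeEquivRight fun p => (Subtype.ext_iff (a1 := f' p)).symm))]
  refine exists_congr fun φ => forall₂_congr fun p q => ?_
  rw [parallel_iff_mapLine_eq hπsurj hπker p.2 q.2,
    parallel_iff_mapLine_eq hπ'surj hπ'ker (φ p).2 (φ q).2]
  simp only [f, f', Subtype.mk.injEq]
end

section
/- Let R and R' be rings and let φ: ℙ(R) → ℙ(R') be a ∥-isomorphism. Then φ is a △-isomorphism if and only if the induced bijection φ̄: ℙ(R/rad R) → ℙ(R'/rad R'), p̄ ↦ (φ(p))‾, is a △-isomorphism. -/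
/-- A ring element congruent to `1` modulo the Jacobson radical is a unit. -/
theorem isUnit_of_map_eq_one {A B : Type*} [Ring A] [Ring B] (f : A →+* B)
    (hker : ∀ a, f a = 0 → a ∈ Ideal.jacobson (⊥ : Ideal A)) {x : A} (hx : f x = 1) :
    IsUnit x := by
  have left_inv : ∀ y, f y = 1 → ∃ s, s * y = 1 := fun y hy => by
    obtain ⟨s, hs⟩ := Ideal.exists_mul_sub_mem_of_sub_one_mem_jacobson y
      (hker (y - 1) (by simp [hy]))
    exact ⟨s, sub_eq_zero.1 (by simpa using hs)⟩
  obtain ⟨s, hs⟩ := left_inv x hx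
  obtain ⟨t, ht⟩ := left_inv s (by simpa [hx] using congrArg f hs)
  have htx : t = x := left_inv_eq_right_inv ht hs
  exact ⟨⟨x, s, htx ▸ ht, hs⟩, rfl⟩

/-- Units lift along surjective ring homomorphisms whose kernel lies in the Jacobson radical. -/
theorem isUnit_of_isUnit_map_of_surjective {A B : Type*} [Ring A] [Ring B] (f : A →+* B)
    (hf : Function.Surjective f) (hker : ∀ a, f a = 0 → a ∈ Ideal.jacobson (⊥ : Ideal A))
    {x : A} (hx : IsUnit (f x)) : IsUnit x := by
  obtain ⟨u, hu⟩ := hx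
  obtain ⟨y, hy⟩ := hf ↑u⁻¹
  obtain ⟨v, hv⟩ := isUnit_of_map_eq_one f hker (x := x * y) (by simp [hy, ← hu])
  obtain ⟨w, hw⟩ := isUnit_of_map_eq_one f hker (x := y * x) (by simp [hy, ← hu])
  refine isUnit_iff_exists_and_exists.2 ⟨⟨y * ↑v⁻¹, ?_⟩, ⟨↑w⁻¹ * y, ?_⟩⟩
  · rw [← mul_assoc, ← hv, Units.mul_inv]
  · rw [mul_assoc, ← hw, Units.inv_mul]

/-- A square matrix is invertible as soon as it is so modulo the Jacobson radical. -/
theorem Matrix.isUnit_of_isUnit_map_of_surjective {n R S : Type*} [Fintype n] [DecidableEq n]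
    [Ring R] [Ring S]
    (π : R →+* S) (hπ : Function.Surjective π)
    (hker : ∀ a, π a = 0 → a ∈ JacobsonRadical R) {M : Matrix n n R}
    (hM : IsUnit (π.mapMatrix M)) : IsUnit M := by
  refine _root_.isUnit_of_isUnit_map_of_surjective π.mapMatrix (fun N => ?_) (fun N hN => ?_) hM
  · obtain ⟨g, hg⟩ := hπ.hasRightInverse
    exact ⟨N.map g, by ext i j; simp [hg _]⟩
  · have h := Ideal.matrix_jacobson_le (n := n) (⊥ : Ideal R)
    rw [Ideal.matrix_bot] at h
    refine h fun i j => Submodule.mem_sInf.2 fun I hI => hker _ ?_ I hI.2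
    simpa using congrFun (congrFun hN i) j

/-- If two matrices over a ring have rows generating the same submodules and one of them is
invertible, with every row of the other being a row of an invertible matrix, then the latter is
invertible. -/
theorem isUnit_of_span_row_eq {S : Type*} [Ring S] (g h k : (Matrix (Fin 2) (Fin 2) S)ˣ)
    (h₀ : Submodule.span S {(g.val 0 0, g.val 0 1)} = Submodule.span S {(k.val 0 0, k.val 0 1)})
    (h₁ : Submodule.span S {(h.val 0 0, h.val 0 1)} = Submodule.span S {(k.val 1 0, k.val 1 1)}) :
    IsUnit !![g.val 0 0, g.val 0 1; h.val 0 0, h.val 0 1] := by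
  have mem : ∀ {x y : S × S}, Submodule.span S {x} = Submodule.span S {y} → ∃ s : S, s • y = x :=
    fun e => Submodule.mem_span_singleton.1 (e ▸ Submodule.mem_span_singleton_self _)
  have cancel : ∀ (u : (Matrix (Fin 2) (Fin 2) S)ˣ) (i : Fin 2) (c : S),
      c * u.val i 0 = u.val i 0 → c * u.val i 1 = u.val i 1 → c = 1 := fun u i c e₀ e₁ => by
    have e := congrFun (congrFun u.mul_inv i) i
    simp only [Matrix.mul_apply, Fin.sum_univ_two, Matrix.one_apply_eq] at e
    calc c = c * (u.val i 0 * u.inv 0 i + u.val i 1 * u.inv 1 i) := by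
          rw [show u.inv = (↑u⁻¹ : Matrix (Fin 2) (Fin 2) S) from rfl, e, mul_one]
      _ = 1 := by
          rw [mul_add, ← mul_assoc, ← mul_assoc, e₀, e₁]
          exact e
  obtain ⟨s, hs⟩ := mem h₀
  obtain ⟨s', hs'⟩ := mem h₀.symm
  obtain ⟨t, ht⟩ := mem h₁
  obtain ⟨t', ht'⟩ := mem h₁.symm
  simp only [Prod.smul_mk, smul_eq_mul, Prod.mk.injEq] at hs hs' ht ht'
  have ss' : s * s' = 1 := cancel g 0 _ (by rw [mul_assoc, hs'.1, hs.1])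
    (by rw [mul_assoc, hs'.2, hs.2])
  have s's : s' * s = 1 := cancel k 0 _ (by rw [mul_assoc, hs.1, hs'.1])
    (by rw [mul_assoc, hs.2, hs'.2])
  have tt' : t * t' = 1 := cancel h 0 _ (by rw [mul_assoc, ht'.1, ht.1])
    (by rw [mul_assoc, ht'.2, ht.2])
  have t't : t' * t = 1 := cancel k 1 _ (by rw [mul_assoc, ht.1, ht'.1])
    (by rw [mul_assoc, ht.2, ht'.2])
  have hD : IsUnit !![s, 0; 0, t] :=
    ⟨⟨!![s, 0; 0, t], !![s', 0; 0, t'], by simp [Matrix.one_fin_two, ss', tt'],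
      by simp [Matrix.one_fin_two, s's, t't]⟩, rfl⟩
  convert hD.mul k.isUnit using 1
  rw [Matrix.eta_fin_two k.val]
  simp [← hs.1, ← hs.2, ← ht.1, ← ht.2]

theorem Distant.of_isUnit {R : Type*} [Ring R] {a b c d : R} (h : IsUnit !![a, b; c, d]) :
    Distant (Submodule.span R {(a, b)}) (Submodule.span R {(c, d)}) := by
  obtain ⟨u, hu⟩ := h
  exact ⟨u, by simp [hu], by simp [hu]⟩

/-- Every row of an invertible `2 × 2` matrix generates a point. -/
theorem IsPoint.span_row {R : Type*} [Ring R] (g : (Matrix (Fin 2) (Fin 2) R)ˣ) (i : Fin 2) :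
    IsPoint R (Submodule.span R {(g.val i 0, g.val i 1)}) := by
  let w : (Matrix (Fin 2) (Fin 2) R)ˣ :=
    ⟨!![0, 1; 1, 0], !![0, 1; 1, 0], by simp [Matrix.one_fin_two], by simp [Matrix.one_fin_two]⟩
  fin_cases i
  · exact ⟨g, rfl⟩
  · exact ⟨w * g, by simp [w, Matrix.mul_apply]⟩

/-- Two points are distant if and only if their reductions modulo the radical are. -/
theorem distant_iff_distant_reduction {R S : Type*} [Ring R] [Ring S]
    (π : R →+* S) (hπ : Function.Surjective π)
    (hker : ∀ a : R, π a = 0 ↔ a ∈ JacobsonRadical R)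
    (Φ : Submodule R (R × R) → Submodule S (S × S))
    (hΦ : ∀ a b : R, IsPoint R (Submodule.span R {(a, b)}) →
      Φ (Submodule.span R {(a, b)}) = Submodule.span S {(π a, π b)})
    {p q : Submodule R (R × R)} (hp : IsPoint R p)
    (hq : IsPoint R q) : Distant p q ↔ Distant (Φ p) (Φ q) := by
  constructor
  · rintro ⟨g, rfl, rfl⟩
    exact ⟨Units.map π.mapMatrix.toMonoidHom g, by simp [hΦ _ _ (IsPoint.span_row g 0)],
      by simp [hΦ _ _ (IsPoint.span_row g 1)]⟩
  · rintro ⟨k, hk₀, hk₁⟩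
    obtain ⟨g, rfl⟩ := hp
    obtain ⟨h, rfl⟩ := hq
    rw [hΦ _ _ (IsPoint.span_row g 0)] at hk₀
    rw [hΦ _ _ (IsPoint.span_row h 0)] at hk₁
    refine Distant.of_isUnit
      (Matrix.isUnit_of_isUnit_map_of_surjective π hπ (fun a => (hker a).1) ?_)
    have := isUnit_of_span_row_eq (Units.map π.mapMatrix.toMonoidHom g)
      (Units.map π.mapMatrix.toMonoidHom h) k (by simpa using hk₀) (by simpa using hk₁)
    convert this using 1
    ext i j
    fin_cases i <;> fin_cases j <;> simp

/-- Every point over the quotient by the radical is the reduction of a point. -/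
theorem exists_isPoint_reduction_eq {R S : Type*} [Ring R] [Ring S]
    (π : R →+* S) (hπ : Function.Surjective π)
    (hker : ∀ a : R, π a = 0 ↔ a ∈ JacobsonRadical R)
    (Φ : Submodule R (R × R) → Submodule S (S × S))
    (hΦ : ∀ a b : R, IsPoint R (Submodule.span R {(a, b)}) →
      Φ (Submodule.span R {(a, b)}) = Submodule.span S {(π a, π b)})
    {pb : Submodule S (S × S)} (hpb : IsPoint S pb) :
    ∃ p, IsPoint R p ∧ Φ p = pb := by
  obtain ⟨k, rfl⟩ := hpb
  obtain ⟨f, hf⟩ := hπ.hasRightInverse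
  have hM : π.mapMatrix (k.val.map f) = k.val := by ext i j; simp [hf _]
  obtain ⟨g, hg⟩ := Matrix.isUnit_of_isUnit_map_of_surjective π (fun s => ⟨f s, hf s⟩)
    (fun a => (hker a).1) (hM ▸ k.isUnit)
  refine ⟨_, IsPoint.span_row g 0, ?_⟩
  rw [hΦ _ _ (IsPoint.span_row g 0), hg]
  simp [hf _]

/-- Let `φ : ℙ(R) → ℙ(R')` be a `∥`-isomorphism, and let
`φ̄ : ℙ(R/rad R) → ℙ(R'/rad R')` be the induced bijection, `p̄ ↦ (φ p)‾` (the quotients are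
encoded by surjective ring homomorphisms `π, π'` with kernel the Jacobson radical, and the
induced point maps `π̃ = Φ`, `π̃' = Φ'`).  Then `φ` is a `△`-isomorphism iff `φ̄` is a
`△`-isomorphism. -/
theorem stmt_7 {R R' S S' : Type*} [Ring R] [Ring R'] [Ring S] [Ring S']
    (π : R →+* S) (hπsurj : Function.Surjective π)
    (hπker : ∀ a : R, π a = 0 ↔ a ∈ JacobsonRadical R)
    (π' : R' →+* S') (hπ'surj : Function.Surjective π')
    (hπ'ker : ∀ a : R', π' a = 0 ↔ a ∈ JacobsonRadical R')
    (Φ : Submodule R (R × R) → Submodule S (S × S))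
    (hΦ : ∀ a b : R, IsPoint R (Submodule.span R {(a, b)}) →
      Φ (Submodule.span R {(a, b)}) = Submodule.span S {(π a, π b)})
    (hΦpt : ∀ p, IsPoint R p → IsPoint S (Φ p))
    (Φ' : Submodule R' (R' × R') → Submodule S' (S' × S'))
    (hΦ' : ∀ a b : R', IsPoint R' (Submodule.span R' {(a, b)}) →
      Φ' (Submodule.span R' {(a, b)}) = Submodule.span S' {(π' a, π' b)})
    (hΦ'pt : ∀ p', IsPoint R' p' → IsPoint S' (Φ' p'))
    (φ : {p : Submodule R (R × R) // IsPoint R p} ≃ {p' : Submodule R' (R' × R') // IsPoint R' p'})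
    (hφpar : ∀ p q : {p : Submodule R (R × R) // IsPoint R p},
      (Parallel p.1 q.1 ↔ Parallel (φ p).1 (φ q).1))
    (φbar : {p : Submodule S (S × S) // IsPoint S p} ≃ {p' : Submodule S' (S' × S') // IsPoint S' p'})
    (hφbar : ∀ p : {p : Submodule R (R × R) // IsPoint R p},
      (φbar ⟨Φ p.1, hΦpt p.1 p.2⟩).1 = Φ' (φ p).1) :
    (∀ p q : {p : Submodule R (R × R) // IsPoint R p},
        (Distant p.1 q.1 ↔ Distant (φ p).1 (φ q).1)) ↔
      (∀ pb qb : {p : Submodule S (S × S) // IsPoint S p},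
        (Distant pb.1 qb.1 ↔ Distant (φbar pb).1 (φbar qb).1)) := by
  have red := fun p q : {p : Submodule R (R × R) // IsPoint R p} =>
    distant_iff_distant_reduction π hπsurj hπker Φ hΦ p.2 q.2
  have red' := fun p q : {p' : Submodule R' (R' × R') // IsPoint R' p'} =>
    distant_iff_distant_reduction π' hπ'surj hπ'ker Φ' hΦ' p.2 q.2
  constructor
  · rintro h ⟨pb, hpb⟩ ⟨qb, hqb⟩
    obtain ⟨p, hp, rfl⟩ := exists_isPoint_reduction_eq π hπsurj hπker Φ hΦ hpb
    obtain ⟨q, hq, rfl⟩ := exists_isPoint_reduction_eq π hπsurj hπker Φ hΦ hqb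
    rw [hφbar ⟨p, hp⟩, hφbar ⟨q, hq⟩, ← red', ← h]
    exact (red ⟨p, hp⟩ ⟨q, hq⟩).symm
  · intro h p q
    rw [red, red', ← hφbar p, ← hφbar q]
    exact h ⟨Φ p.1, hΦpt _ p.2⟩ ⟨Φ q.1, hΦpt _ q.2⟩
end

section
/- Let R be the ring of n×n matrices over a (not necessarily commutative) field K with n > 1, let R' be the ring of n'×n' matrices over a field K', and let ω: R → R' be a Jordan isomorphism. Then: (1) n = n' and ω is either an isomorphism or an anti-isomorphism of rings; (2) if ω is an isomorphism, there exist a field isomorphism β: K → K' and an invertible matrix G ∈ R'* such that X^ω = G⁻¹ X^β G for all X ∈ R; (3) if ω is an anti-isomorphism, there exist a field anti-isomorphism β: K → K' and an invertible matrix G ∈ R'* such that X^ω = G⁻¹ (X^β)ᵀ G for all X ∈ R. (Here β acts entrywise on the matrix X and ᵀ denotes matrix transposition.) -/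
open MulOpposite

section JordanHom

variable {R S : Type*} [Ring R] [Ring S] {ω : R → S}

theorem jordan_triple (hadd : ∀ x y, ω (x + y) = ω x + ω y)
    (hjordan : ∀ x y, ω (x * y * x) = ω x * ω y * ω x) (a b c : R) :
    ω (a * b * c) + ω (c * b * a) = ω a * ω b * ω c + ω c * ω b * ω a := by
  have h := hjordan (a + c) b
  rw [show (a + c) * b * (a + c) = a * b * a + c * b * c + (a * b * c + c * b * a) by noncomm_ring,
    hadd, hadd, hadd, hadd, hjordan, hjordan] at h
  have h2 : (ω a + ω c) * ω b * (ω a + ω c) = ω a * ω b * ω a + ω c * ω b * ω c +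
    (ω a * ω b * ω c + ω c * ω b * ω a) := by noncomm_ring
  rw [h2] at h
  exact add_left_cancel h

theorem jordan_mul_add_mul (hadd : ∀ x y, ω (x + y) = ω x + ω y) (hone : ω 1 = 1)
    (hjordan : ∀ x y, ω (x * y * x) = ω x * ω y * ω x) (a b : R) :
    ω (a * b) + ω (b * a) = ω a * ω b + ω b * ω a := by
  simpa [hone] using jordan_triple hadd hjordan a b 1 |>.trans (by simp [hone])

theorem jordan_zero (hadd : ∀ x y, ω (x + y) = ω x + ω y) : ω 0 = 0 := by
  simpa using hadd 0 0

/-- The image of each off-diagonal Peirce component of an idempotent under a Jordan homomorphism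
onto a prime ring lies in a single Peirce component. -/
theorem jordan_peirce_dichotomy (hadd : ∀ x y, ω (x + y) = ω x + ω y)
    (hjordan : ∀ x y, ω (x * y * x) = ω x * ω y * ω x) (hsurj : Function.Surjective ω)
    (hprime : ∀ a b : S, (∀ x, a * x * b = 0) → a = 0 ∨ b = 0)
    {e f : R} (hfe : f * e = 0) :
    (∀ x, ω f * ω (e * x * f) * ω e = 0) ∨ (∀ x, ω e * ω (e * x * f) * ω f = 0) := by
  have key (x : R) : ω f * ω (e * x * f) * ω e = 0 ∨ ω e * ω (e * x * f) * ω f = 0 := by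
    refine (hprime _ _ fun y => ?_).symm
    obtain ⟨z, rfl⟩ := hsurj y
    have h : ω (e * x * f) * (ω f * ω z * ω f) * ω (e * x * f) = 0 := by
      rw [← hjordan, ← hjordan]
      convert jordan_zero hadd using 2
      calc e * x * f * (f * z * f) * (e * x * f)
          = e * x * f * f * z * (f * e) * x * f := by noncomm_ring
        _ = 0 := by simp [hfe]
    calc ω e * ω (e * x * f) * ω f * ω z * (ω f * ω (e * x * f) * ω e)
        = ω e * (ω (e * x * f) * (ω f * ω z * ω f) * ω (e * x * f)) * ω e := by noncomm_ring
      _ = 0 := by simp [h]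
  by_contra! hcon
  obtain ⟨⟨x, hx⟩, ⟨y, hy⟩⟩ := hcon
  have hx' := (key x).resolve_left hx
  have hy' := (key y).resolve_right hy
  have hs : ω (e * (x + y) * f) = ω (e * x * f) + ω (e * y * f) := by
    rw [← hadd]; congr 1; noncomm_ring
  rcases key (x + y) with h | h
  · rw [hs, mul_add, add_mul, hy', add_zero] at h
    exact hx h
  · rw [hs, mul_add, add_mul, hx', zero_add] at h
    exact hy h

/-- A pair of orthogonal idempotents summing to `1`. -/
structure ComplIdempotents {A : Type*} [Ring A] (e f : A) : Prop where
  add_eq : e + f = 1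
  left : e * e = e
  right : f * f = f
  mul_eq : e * f = 0
  mul_eq' : f * e = 0

theorem ComplIdempotents.symm {A : Type*} [Ring A] {e f : A} (h : ComplIdempotents e f) :
    ComplIdempotents f e :=
  ⟨by rw [add_comm, h.add_eq], h.right, h.left, h.mul_eq', h.mul_eq⟩

theorem ComplIdempotents.of_idem {A : Type*} [Ring A] {e : A} (h : e * e = e) :
    ComplIdempotents e (1 - e) :=
  ⟨by abel, h, by simp [mul_sub, sub_mul, h], by simp [mul_sub, h], by simp [sub_mul, h]⟩

theorem ComplIdempotents.map_jordan (hadd : ∀ x y, ω (x + y) = ω x + ω y) (hone : ω 1 = 1)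
    (hjordan : ∀ x y, ω (x * y * x) = ω x * ω y * ω x) {e f : R} (h : ComplIdempotents e f) :
    ComplIdempotents (ω e) (ω f) := by
  have hf : ω f = 1 - ω e := by rw [← hone, ← h.add_eq, hadd]; abel
  rw [hf]
  refine .of_idem ?_
  simpa [hone, h.left] using (hjordan e 1).symm

theorem ComplIdempotents.decomp {A : Type*} [Ring A] {e f : A} (h : ComplIdempotents e f) (x : A) :
    x = e * x * e + e * x * f + f * x * e + f * x * f := by
  calc x = (e + f) * x * (e + f) := by simp [h.add_eq]
    _ = _ := by noncomm_ring

theorem ComplIdempotents.mul_decomp {A : Type*} [Ring A] {e f : A} (h : ComplIdempotents e f)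
    (x y : A) : x * y =
      e * x * e * y * e + e * x * f * y * e + e * x * e * y * f + e * x * f * y * f +
        (f * x * e * y * e + f * x * f * y * e + f * x * e * y * f + f * x * f * y * f) := by
  calc x * y = (e + f) * x * (e + f) * y * (e + f) := by simp [h.add_eq]
    _ = _ := by noncomm_ring

theorem jordan_peirce_offdiag (hadd : ∀ x y, ω (x + y) = ω x + ω y) (hone : ω 1 = 1)
    (hjordan : ∀ x y, ω (x * y * x) = ω x * ω y * ω x)
    {e f : R} (hp : ComplIdempotents e f)
    (h₁ : ∀ x, ω f * ω (e * x * f) * ω e = 0) (h₂ : ∀ x, ω e * ω (f * x * e) * ω f = 0)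
    (x : R) : ω (e * x * f) = ω e * ω x * ω f := by
  have hz : ω 0 = 0 := jordan_zero hadd
  have hq := hp.map_jordan hadd hone hjordan
  have hc : ω e * ω (e * x * f) * ω f = ω e * ω x * ω f := by
    have := congrArg (fun t => ω e * t * ω f) (jordan_triple hadd hjordan e x f)
    simp only [mul_add, add_mul, h₂, add_zero] at this
    rw [this]
    calc ω e * (ω e * ω x * ω f) * ω f + ω e * (ω f * ω x * ω e) * ω f
        = (ω e * ω e) * ω x * (ω f * ω f) + (ω e * ω f) * ω x * ω e * ω f := by noncomm_ring
      _ = _ := by rw [hq.left, hq.right, hq.mul_eq]; simp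
  have he0 : ω e * ω (e * x * f) * ω e = 0 := by
    rw [← hjordan]
    convert hz using 2
    calc e * (e * x * f) * e = e * e * x * (f * e) := by noncomm_ring
      _ = 0 := by simp [hp.mul_eq']
  have hf0 : ω f * ω (e * x * f) * ω f = 0 := by
    rw [← hjordan]
    convert hz using 2
    calc f * (e * x * f) * f = (f * e) * x * f * f := by noncomm_ring
      _ = 0 := by simp [hp.mul_eq']
  rw [hq.decomp (ω (e * x * f)), hc, he0, hf0, h₁]
  simp

/-- If `ω` respects Peirce components then it is multiplicative on products whose outer
idempotents are orthogonal. -/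
theorem jordan_mul_of_outer_ne (hadd : ∀ x y, ω (x + y) = ω x + ω y) (hone : ω 1 = 1)
    (hjordan : ∀ x y, ω (x * y * x) = ω x * ω y * ω x)
    {u v w : R} (huw : w * u = 0) (hv : v * v = v) (hv' : ω v * ω v = ω v)
    (huw' : ω w * ω u = 0)
    (h₁ : ∀ x, ω (u * x * v) = ω u * ω x * ω v) (h₂ : ∀ x, ω (v * x * w) = ω v * ω x * ω w)
    (x y : R) : ω (u * x * v * y * w) = ω u * ω x * ω v * ω y * ω w := by
  have h := jordan_mul_add_mul hadd hone hjordan (u * x * v) (v * y * w)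
  rw [h₁, h₂, show v * y * w * (u * x * v) = v * y * (w * u) * x * v by noncomm_ring,
    show u * x * v * (v * y * w) = u * x * (v * v) * y * w by noncomm_ring,
    show ω v * ω y * ω w * (ω u * ω x * ω v) = ω v * ω y * (ω w * ω u) * ω x * ω v by
      noncomm_ring,
    show ω u * ω x * ω v * (ω v * ω y * ω w) = ω u * ω x * (ω v * ω v) * ω y * ω w by
      noncomm_ring, huw, huw', hv, hv'] at h
  simpa [jordan_zero hadd] using h

theorem jordan_mul_of_inner_ne (hadd : ∀ x y, ω (x + y) = ω x + ω y) (hone : ω 1 = 1)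
    (hjordan : ∀ x y, ω (x * y * x) = ω x * ω y * ω x)
    {e f : R} (hp : ComplIdempotents e f)
    (h₁ : ∀ x, ω (e * x * f) = ω e * ω x * ω f) (h₂ : ∀ x, ω (f * x * e) = ω f * ω x * ω e)
    (x y : R) : ω (e * x * f * y * e) = ω e * ω x * ω f * ω y * ω e := by
  have hq := hp.map_jordan hadd hone hjordan
  have h := jordan_mul_add_mul hadd hone hjordan (e * x * f) (f * y * e)
  rw [h₁, h₂] at h
  have h' := congrArg (fun t => ω e * t * ω e) h
  simp only [mul_add, add_mul] at h'
  rw [← hjordan, ← hjordan,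
    show e * (e * x * f * (f * y * e)) * e = (e * e) * x * (f * f) * y * (e * e) by noncomm_ring,
    show e * (f * y * e * (e * x * f)) * e = (e * f) * y * e * e * x * f * e by noncomm_ring,
    show ω e * (ω f * ω y * ω e * (ω e * ω x * ω f)) * ω e =
      (ω e * ω f) * ω y * ω e * ω e * ω x * ω f * ω e by noncomm_ring,
    show ω e * (ω e * ω x * ω f * (ω f * ω y * ω e)) * ω e =
      (ω e * ω e) * ω x * (ω f * ω f) * ω y * (ω e * ω e) by noncomm_ring,
    hp.mul_eq, hq.mul_eq, hp.left, hp.right, hq.left, hq.right] at h'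
  simpa [jordan_zero hadd] using h'

theorem jordan_mul_of_corner (hadd : ∀ x y, ω (x + y) = ω x + ω y) (hone : ω 1 = 1)
    (hjordan : ∀ x y, ω (x * y * x) = ω x * ω y * ω x) (hsurj : Function.Surjective ω)
    (hprime : ∀ a b : S, (∀ x, a * x * b = 0) → a = 0 ∨ b = 0)
    {e f : R} (hp : ComplIdempotents e f) (hf0 : ω f ≠ 0)
    (h : ∀ x, ω (f * x * e) = ω f * ω x * ω e)
    (x y : R) : ω (e * x * e * y * e) = ω e * ω x * ω e * ω y * ω e := by
  have hq := hp.map_jordan hadd hone hjordan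
  have mul_corner := jordan_mul_of_outer_ne hadd hone hjordan
    hp.mul_eq hp.left hq.left hq.mul_eq h (fun x => hjordan e x)
  rw [← sub_eq_zero]
  refine (hprime (ω f) _ fun s => ?_).resolve_left hf0
  obtain ⟨t, rfl⟩ := hsurj s
  have h₁ := mul_corner t (x * e * y)
  have h₂ := mul_corner (t * e * x) y
  have h₃ := mul_corner t x
  have h₄ : ω f * ω (t * e * x) * ω e = ω f * ω t * ω e * ω x * ω e := by
    rw [← h, ← h₃]; congr 1; noncomm_ring
  rw [h₄, show f * (t * e * x) * e * y * e = f * t * e * (x * e * y) * e by noncomm_ring, h₁] at h₂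
  have h₅ : ω (e * x * e * y * e) = ω e * ω (x * e * y) * ω e := by
    rw [← hjordan]; congr 1; noncomm_ring
  rw [h₅, mul_sub, sub_eq_zero]
  simpa only [mul_assoc] using h₂

/-- A surjective Jordan homomorphism onto a prime ring that respects the off-diagonal Peirce
components of a pair of complementary idempotents is multiplicative. -/
theorem jordan_map_mul_of_peirce (hadd : ∀ x y, ω (x + y) = ω x + ω y) (hone : ω 1 = 1)
    (hjordan : ∀ x y, ω (x * y * x) = ω x * ω y * ω x) (hsurj : Function.Surjective ω)
    (hprime : ∀ a b : S, (∀ x, a * x * b = 0) → a = 0 ∨ b = 0)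
    {e f : R} (hp : ComplIdempotents e f) (he0 : ω e ≠ 0) (hf0 : ω f ≠ 0)
    (h₁ : ∀ x, ω f * ω (e * x * f) * ω e = 0) (h₂ : ∀ x, ω e * ω (f * x * e) * ω f = 0)
    (x y : R) : ω (x * y) = ω x * ω y := by
  have hq := hp.map_jordan hadd hone hjordan
  have hef := jordan_peirce_offdiag hadd hone hjordan hp h₁ h₂
  have hfe := jordan_peirce_offdiag hadd hone hjordan hp.symm h₂ h₁
  have hee := hjordan e
  have hff := hjordan f
  have eee := jordan_mul_of_corner hadd hone hjordan hsurj hprime hp hf0 hfe x y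
  have fff := jordan_mul_of_corner hadd hone hjordan hsurj hprime hp.symm he0 hef x y
  have efe := jordan_mul_of_inner_ne hadd hone hjordan hp hef hfe x y
  have fef := jordan_mul_of_inner_ne hadd hone hjordan hp.symm hfe hef x y
  have eef := jordan_mul_of_outer_ne hadd hone hjordan
    hp.mul_eq' hp.left hq.left hq.mul_eq' hee hef x y
  have eff := jordan_mul_of_outer_ne hadd hone hjordan
    hp.mul_eq' hp.right hq.right hq.mul_eq' hef hff x y
  have fee := jordan_mul_of_outer_ne hadd hone hjordan
    hp.mul_eq hp.left hq.left hq.mul_eq hfe hee x y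
  have ffe := jordan_mul_of_outer_ne hadd hone hjordan
    hp.mul_eq hp.right hq.right hq.mul_eq hff hfe x y
  rw [hp.mul_decomp x y, hq.mul_decomp]
  simp only [hadd, eee, fff, efe, fef, eef, eff, fee, ffe]

/-- A Jordan isomorphism from a ring with a nontrivial idempotent onto a prime ring is
multiplicative or antimultiplicative. -/
theorem jordan_map_mul_or_map_mul_swap (hadd : ∀ x y, ω (x + y) = ω x + ω y) (hone : ω 1 = 1)
    (hjordan : ∀ x y, ω (x * y * x) = ω x * ω y * ω x) (hbij : Function.Bijective ω)
    (hprime : ∀ a b : S, (∀ x, a * x * b = 0) → a = 0 ∨ b = 0)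
    {e : R} (he : e * e = e) (he0 : e ≠ 0) (he1 : e ≠ 1) :
    (∀ x y, ω (x * y) = ω x * ω y) ∨ (∀ x y, ω (x * y) = ω y * ω x) := by
  have hz : ω 0 = 0 := jordan_zero hadd
  obtain ⟨f, hp⟩ : ∃ f, ComplIdempotents e f := ⟨_, .of_idem he⟩
  have hq := hp.map_jordan hadd hone hjordan
  have hE : ω e ≠ 0 := fun h => he0 (hbij.1 (h.trans hz.symm))
  have hF : ω f ≠ 0 := fun h => he1 (by
    have := hp.add_eq
    rwa [hbij.1 (h.trans hz.symm), add_zero] at this)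
  have absurd_of {e f : R} (hq : ComplIdempotents (ω e) (ω f)) (hE : ω e ≠ 0) (hF : ω f ≠ 0)
      (h₁ : ∀ x, ω f * ω (e * x * f) * ω e = 0) (h₂ : ∀ x, ω f * ω (f * x * e) * ω e = 0) :
      False := by
    refine (hprime (ω f) (ω e) fun s => ?_).elim hF hE
    obtain ⟨x, rfl⟩ := hbij.2 s
    have := congrArg (fun t => ω f * t * ω e) (jordan_triple hadd hjordan e x f)
    simp only [mul_add, add_mul, h₁, h₂] at this
    rw [show ω f * (ω e * ω x * ω f) * ω e = (ω f * ω e) * ω x * (ω f * ω e) by noncomm_ring,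
      show ω f * (ω f * ω x * ω e) * ω e = (ω f * ω f) * ω x * (ω e * ω e) by noncomm_ring,
      hq.mul_eq', hq.left, hq.right] at this
    simpa using this.symm
  rcases jordan_peirce_dichotomy hadd hjordan hbij.2 hprime hp.mul_eq' with h₁ | h₁ <;>
  rcases jordan_peirce_dichotomy hadd hjordan hbij.2 hprime hp.mul_eq with h₂ | h₂
  · exact .inl (jordan_map_mul_of_peirce hadd hone hjordan hbij.2 hprime hp hE hF h₁ h₂)
  · exact (absurd_of hq hE hF h₁ h₂).elim
  · exact (absurd_of hq.symm hF hE h₂ h₁).elim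
  · right
    have hop := jordan_map_mul_of_peirce (S := Sᵐᵒᵖ) (ω := fun x => op (ω x)) (e := e) (f := f)
      (fun x y => by simp [hadd]) (by simp [hone])
      (fun x y => by rw [hjordan]; simp [mul_assoc])
      (op_surjective.comp hbij.2)
      (fun a b h => ?_) hp (by simpa using hE) (by simpa using hF)
      (fun x => ?_) (fun x => ?_)
    · intro x y
      exact op_injective (by simpa using hop x y)
    · refine (hprime b.unop a.unop fun x => ?_).symm.imp (unop_injective ·) (unop_injective ·)
      simpa [mul_assoc] using congrArg unop (h (op x))
    · exact unop_injective (by simpa [mul_assoc] using h₁ x)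
    · exact unop_injective (by simpa [mul_assoc] using h₂ x)

end JordanHom

section MatrixIso

open Matrix

theorem Matrix.eq_zero_or_eq_zero_of_mul_mul_eq_zero {m D : Type*} [Fintype m] [DecidableEq m]
    [DivisionRing D] (A B : Matrix m m D) (h : ∀ X, A * X * B = 0) : A = 0 ∨ B = 0 := by
  by_contra! hcon
  obtain ⟨hA, hB⟩ := hcon
  obtain ⟨i, j, hij⟩ : ∃ i j, A i j ≠ 0 := by
    by_contra! hA'; exact hA (Matrix.ext hA')
  obtain ⟨k, l, hkl⟩ : ∃ k l, B k l ≠ 0 := by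
    by_contra! hB'; exact hB (Matrix.ext hB')
  have := congrFun (congrFun (h (single j k 1)) i) l
  simp [Matrix.mul_apply, Matrix.single_apply, Finset.sum_ite_eq, ite_and] at this
  tauto

/-- An isomorphism of matrix rings over division rings is semilinear with respect to an
isomorphism of the division rings, in terms of a suitable basis of row vectors. -/
theorem Matrix.exists_basis_of_ringEquiv {ι κ D D' : Type*} [Fintype ι] [DecidableEq ι]
    [Nonempty ι] [Fintype κ] [DecidableEq κ] [DivisionRing D] [DivisionRing D']
    (ω : Matrix ι ι D ≃+* Matrix κ κ D') :
    ∃ (β : D ≃+* D') (w : Module.Basis ι D' (κ → D')),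
      ∀ i X, w i ᵥ* ω X = ∑ j, β (X i j) • w j := by
  obtain ⟨o⟩ := ‹Nonempty ι›
  have hE : ω (single o o 1) ≠ 0 := by
    rw [Ne, map_eq_zero_iff ω ω.injective]
    intro h
    simpa using congrFun (congrFun h o) o
  obtain ⟨p, q, hpq⟩ : ∃ i j, ω (single o o 1) i j ≠ 0 := by
    by_contra! h; exact hE (Matrix.ext h)
  obtain ⟨w, hwE, hw0⟩ : ∃ w : κ → D', w ᵥ* ω (single o o 1) = w ∧ w ≠ 0 := by
    refine ⟨ω (single o o 1) p, ?_, fun h => hpq (congrFun h q)⟩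
    have h : ω (single o o 1) * ω (single o o 1) = ω (single o o 1) := by
      rw [← map_mul]; simp
    exact congrFun h p
  obtain ⟨k, hk⟩ : ∃ k, w k ≠ 0 := by
    by_contra! h; exact hw0 (funext h)
  -- the matrix of the rank one map sending `w` to `c • w`
  let P (c : D') : Matrix κ κ D' := vecMulVec (Pi.single k ((w k)⁻¹ * c)) w
  have hP (u : κ → D') (c : D') : u ᵥ* P c = (u k * ((w k)⁻¹ * c)) • w := by
    ext j
    simp [P, vecMul, dotProduct, vecMulVec_apply, Pi.single_apply, ← mul_assoc]
  have hPw (c : D') : w ᵥ* P c = c • w := by rw [hP, mul_inv_cancel_left₀ hk]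
  -- compression by the idempotent
  have corner (c : D') : ∃ x : D, ω (single o o 1) * P c * ω (single o o 1) = ω (single o o x) := by
    obtain ⟨X, hX⟩ := ω.surjective (P c)
    refine ⟨X o o, ?_⟩
    rw [← hX, ← map_mul, ← map_mul, single_mul_mul_single]
    simp
  have hx1 (x y : D) : ω (single o o (x * y)) = ω (single o o x) * ω (single o o y) := by
    rw [← map_mul]; simp
  have line (u : κ → D') (hu : u ᵥ* ω (single o o 1) = u) : ∃ c : D', u = c • w := by
    obtain ⟨x, hx⟩ := corner 1
    have hwx : w ᵥ* ω (single o o x) = w := by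
      rw [← hx, ← vecMul_vecMul, ← vecMul_vecMul, hwE, hPw, one_smul, hwE]
    have hx0 : x ≠ 0 := by
      rintro rfl
      apply hw0
      simpa using hwx.symm
    have hux : u ᵥ* ω (single o o x) = (u k * ((w k)⁻¹ * 1)) • w := by
      rw [← hx, ← vecMul_vecMul, ← vecMul_vecMul, hu, hP, smul_vecMul, hwE]
    have hxx : w ᵥ* ω (single o o x⁻¹) = w := by
      conv_lhs => rw [← hwx, vecMul_vecMul, ← hx1, mul_inv_cancel₀ hx0, hwE]
    refine ⟨u k * ((w k)⁻¹ * 1), ?_⟩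
    calc u = u ᵥ* ω (single o o (x * x⁻¹)) := by rw [mul_inv_cancel₀ hx0, hu]
      _ = _ := by rw [hx1, ← vecMul_vecMul, hux, smul_vecMul, hxx]
  have hβ (x : D) : ∃ c : D', w ᵥ* ω (single o o x) = c • w := by
    apply line
    rw [vecMul_vecMul, ← hx1, mul_one]
  choose b hb using hβ
  have inj {c d : D'} (h : c • w = d • w) : c = d := smul_left_injective D' hw0 h
  let βh : D →+* D' :=
    { toFun := b
      map_one' := inj (by rw [← hb, hwE, one_smul])
      map_zero' := inj (by rw [← hb]; simp)
      map_mul' := fun x y => inj (by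
        rw [← hb, hx1, ← vecMul_vecMul, hb, smul_vecMul, hb, smul_smul])
      map_add' := fun x y => inj (by
        rw [← hb, single_add, map_add, vecMul_add, hb, hb, add_smul]) }
  have hβsurj : Function.Surjective βh := fun c => by
    obtain ⟨x, hx⟩ := corner c
    refine ⟨x, inj ?_⟩
    change b x • w = c • w
    rw [← hb, ← hx, ← vecMul_vecMul, ← vecMul_vecMul, hwE, hPw, smul_vecMul, hwE]
  let β : D ≃+* D' := RingEquiv.ofBijective βh ⟨βh.injective, hβsurj⟩
  let v (i : ι) : κ → D' := w ᵥ* ω (single o i 1)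
  have hv (i : ι) : v i ᵥ* ω (single i o 1) = w := by
    simp only [v]
    rw [vecMul_vecMul, ← map_mul]; simpa using hwE
  have hv' (i j : ι) (hij : i ≠ j) : v i ᵥ* ω (single j o 1) = 0 := by
    simp only [v]
    rw [vecMul_vecMul, ← map_mul]; simp [hij]
  have hli : LinearIndependent D' v := by
    rw [Fintype.linearIndependent_iff]
    intro g hg i
    have h := congrArg (· ᵥ* ω (single i o 1)) hg
    simp only [sum_vecMul, smul_vecMul, zero_vecMul] at h
    rw [Finset.sum_eq_single i (fun j _ hj => by rw [hv' j i hj, smul_zero]) (by simp), hv] at h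
    exact (smul_eq_zero.1 h).resolve_right hw0
  have hsp : ⊤ ≤ Submodule.span D' (Set.range v) := by
    intro u _
    have h1 : u = ∑ i, u ᵥ* ω (single i i 1) := by
      rw [← vecMul_sum, ← map_sum, sum_single_one, map_one, vecMul_one]
    rw [h1]
    refine Submodule.sum_mem _ fun i _ => ?_
    obtain ⟨c, hc⟩ := line (u ᵥ* ω (single i o 1)) (by rw [vecMul_vecMul, ← map_mul]; simp)
    have : u ᵥ* ω (single i i 1) = c • v i := by
      rw [← smul_vecMul, ← hc, vecMul_vecMul, ← map_mul]; simp
    rw [this]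
    exact Submodule.smul_mem _ _ (Submodule.subset_span ⟨i, rfl⟩)
  refine ⟨β, Module.Basis.mk hli hsp, fun i X => ?_⟩
  simp only [Module.Basis.mk_apply]
  have hrow : single o i 1 * X = ∑ j, single o o (X i j) * single o j 1 := by
    ext a c
    by_cases ha : a = o
    · subst ha
      simp [Matrix.sum_apply, Matrix.single_apply]
    · simp [Matrix.sum_apply, ha, Ne.symm ha]
  change (w ᵥ* ω (single o i 1)) ᵥ* ω X = _
  rw [vecMul_vecMul, ← map_mul, hrow, map_sum, vecMul_sum]
  refine Finset.sum_congr rfl fun j _ => ?_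
  rw [map_mul, ← vecMul_vecMul, hb, smul_vecMul]
  rfl

theorem Matrix.exists_conj_of_ringEquiv {D D' : Type*} [DivisionRing D] [DivisionRing D']
    {n n' : ℕ} (hn : 0 < n)
    (ω : Matrix (Fin n) (Fin n) D ≃+* Matrix (Fin n') (Fin n') D') :
    ∃ (e : n = n') (β : D ≃+* D') (G : (Matrix (Fin n') (Fin n') D')ˣ),
      ∀ X, ω X = (G⁻¹).val * reindex (finCongr e) (finCongr e) (X.map β) * G.val := by
  have := Fin.pos_iff_nonempty.1 hn
  obtain ⟨β, w, hw⟩ := exists_basis_of_ringEquiv ω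
  have e : n = n' := by
    simpa using (Module.finrank_eq_card_basis w).symm
  subst e
  let G : Matrix (Fin n) (Fin n) D' := of fun i => w i
  let H : Matrix (Fin n) (Fin n) D' := of fun i => w.repr (Pi.single i 1)
  have hHG : H * G = 1 := by
    ext i j
    have h := congrFun (w.sum_repr (Pi.single i 1)) j
    simpa [Matrix.mul_apply, H, G, Matrix.one_apply, Pi.single_apply, eq_comm] using h
  refine ⟨rfl, β, ⟨G, H, mul_eq_one_comm.1 hHG, hHG⟩, fun X => ?_⟩
  have hGX : G * ω X = X.map β * G := by
    ext i j
    have h := congrFun (hw i X) j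
    simpa [Matrix.mul_apply, G, vecMul, dotProduct] using h
  change ω X = H * _ * G
  rw [mul_assoc]
  have : reindex (finCongr rfl) (finCongr rfl) (X.map β) = X.map β := by ext; simp
  rw [this, ← hGX, ← mul_assoc, hHG, one_mul]

end MatrixIso

/-- Let `R = Mat_n(K)` with `n > 1`, `R' = Mat_{n'}(K')`, and let
`ω : R → R'` be a Jordan isomorphism (an additive bijection with `ω 1 = 1` and
`ω (XYX) = ω X * ω Y * ω X`).  Then (1) `n = n'` and `ω` is an isomorphism or an
anti-isomorphism; (2) if `ω` is an isomorphism then `ω X = G⁻¹ • X^β • G` for a field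
isomorphism `β : K → K'` acting entrywise and some `G ∈ R'ˣ`; (3) if `ω` is an
anti-isomorphism then `ω X = G⁻¹ • (X^β)ᵀ • G` for a field anti-isomorphism `β : K → K'`
and some `G ∈ R'ˣ`. -/
theorem stmt_10 {K K' : Type*} [DivisionRing K] [DivisionRing K'] {n n' : ℕ}
    (hn : 1 < n) (hn' : 0 < n')
    (ω : Matrix (Fin n) (Fin n) K → Matrix (Fin n') (Fin n') K')
    (hbij : Function.Bijective ω)
    (hadd : ∀ X Y, ω (X + Y) = ω X + ω Y)
    (hone : ω 1 = 1)
    (hjordan : ∀ X Y, ω (X * Y * X) = ω X * ω Y * ω X) :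
    (n = n' ∧
      ((∀ X Y, ω (X * Y) = ω X * ω Y) ∨ (∀ X Y, ω (X * Y) = ω Y * ω X))) ∧
    ((∀ X Y, ω (X * Y) = ω X * ω Y) →
      ∃ (e : n = n') (β : K ≃+* K') (G : (Matrix (Fin n') (Fin n') K')ˣ),
        ∀ X, ω X = (G⁻¹).val * Matrix.reindex (finCongr e) (finCongr e) (X.map β) * G.val) ∧
    ((∀ X Y, ω (X * Y) = ω Y * ω X) →
      ∃ (e : n = n') (β : K ≃+* K'ᵐᵒᵖ) (G : (Matrix (Fin n') (Fin n') K')ˣ),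
        ∀ X, ω X = (G⁻¹).val *
          (Matrix.reindex (finCongr e) (finCongr e) (X.map (fun c => unop (β c)))).transpose *
          G.val) := by
  have hiso : (∀ X Y, ω (X * Y) = ω X * ω Y) →
      ∃ (e : n = n') (β : K ≃+* K') (G : (Matrix (Fin n') (Fin n') K')ˣ),
        ∀ X, ω X = (G⁻¹).val * Matrix.reindex (finCongr e) (finCongr e) (X.map β) * G.val :=
    fun hmul => Matrix.exists_conj_of_ringEquiv (by omega)
      { Equiv.ofBijective ω hbij with map_mul' := hmul, map_add' := hadd }
  have hanti : (∀ X Y, ω (X * Y) = ω Y * ω X) →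
      ∃ (e : n = n') (β : K ≃+* K'ᵐᵒᵖ) (G : (Matrix (Fin n') (Fin n') K')ˣ),
        ∀ X, ω X = (G⁻¹).val *
          (Matrix.reindex (finCongr e) (finCongr e) (X.map (fun c => unop (β c)))).transpose *
          G.val := by
    intro hmul
    let ω₀ : Matrix (Fin n) (Fin n) K ≃+* (Matrix (Fin n') (Fin n') K')ᵐᵒᵖ :=
      { (Equiv.ofBijective ω hbij).trans opEquiv with
        map_mul' := fun X Y => congrArg op (hmul X Y)
        map_add' := fun X Y => congrArg op (hadd X Y) }
    let φ : Matrix (Fin n') (Fin n') K'ᵐᵒᵖ ≃+* (Matrix (Fin n') (Fin n') K')ᵐᵒᵖ :=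
      RingEquiv.mopMatrix
    obtain ⟨e, β, G, h⟩ := Matrix.exists_conj_of_ringEquiv (by omega) (ω₀.trans φ.symm)
    refine ⟨e, β, ⟨unop (φ (G⁻¹).val), unop (φ G.val), ?_, ?_⟩, fun X => ?_⟩
    · rw [← unop_mul, ← map_mul]; simp
    · rw [← unop_mul, ← map_mul]; simp
    · have hX := congrArg (fun Y => unop (φ Y)) (h X)
      simp only [map_mul, unop_mul, RingEquiv.trans_apply, RingEquiv.apply_symm_apply] at hX
      rw [← mul_assoc] at hX
      exact hX
  have hor := jordan_map_mul_or_map_mul_swap hadd hone hjordan hbij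
    Matrix.eq_zero_or_eq_zero_of_mul_mul_eq_zero
    (e := Matrix.single (⟨0, by omega⟩ : Fin n) ⟨0, by omega⟩ 1) (by simp)
    (fun h => by simpa using congrFun (congrFun h ⟨0, by omega⟩) ⟨0, by omega⟩)
    (fun h => by
      have := congrFun (congrFun h ⟨1, hn⟩) ⟨1, hn⟩
      simp at this)
  exact ⟨⟨hor.elim (fun h => (hiso h).1) (fun h => (hanti h).1), hor⟩, hiso, hanti⟩
end
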